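/- arXiv:1306.1157 — 2 statements merged into one kernel-verified Lean document; each statement's English description precedes it below -/
import Mathlib

section
/- A scalar (dimension 1) perfect linear index coding solution over some finite field exists for the index coding problem I^D(Z,R) constructed from a discrete polymatroid D if and only if D is representable over some finite field. -/
open scoped Classical

/-- Sum of the components of `u` indexed by the elements of `A`. -/
noncomputable def setSum {r : ℕ} (u : Fin r → ℕ) (A : Set (Fin r)) : ℕ :=
  ∑ i ∈ Finset.univ.filter (· ∈ A), u i

/-- A discrete polymatroid on the ground set `{1,…,r}` (modelled as `Fin r`). -/
structure DiscretePolymatroid (r : ℕ) where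
  carrier : Set (Fin r → ℕ)
  nonempty : carrier.Nonempty
  finite : carrier.Finite
  lower : ∀ u ∈ carrier, ∀ v : Fin r → ℕ, (∀ i, v i ≤ u i) → v ∈ carrier
  exchange : ∀ u ∈ carrier, ∀ v ∈ carrier, (∑ i, u i) < (∑ i, v i) →
    ∃ w ∈ carrier, (∀ i, u i ≤ w i) ∧ u ≠ w ∧ ∀ i, w i ≤ max (u i) (v i)

namespace DiscretePolymatroid

variable {r : ℕ} (D : DiscretePolymatroid r)

/-- The rank function of a discrete polymatroid. -/
noncomputable def rho (A : Set (Fin r)) : ℕ :=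
  D.finite.toFinset.sup fun u => setSum u A

/-- `ρ_max(D) = max_i ρ({i})`. -/
noncomputable def rhoMax : ℕ := Finset.univ.sup fun i : Fin r => D.rho {i}

/-- The rank of the discrete polymatroid (the common component sum of its basis vectors). -/
noncomputable def rank : ℕ := D.rho Set.univ

end DiscretePolymatroid

/-- The subspaces `V i` of `F^d` represent the rank function `ρ'` when
`dim (∑_{i ∈ X} V i) = ρ'(X)` for every `X`. -/
def RepFnOver (r : ℕ) (ρ' : Set (Fin r) → ℕ) (F : Type) [Field F] : Prop :=
  ∃ (d : ℕ) (V : Fin r → Submodule F (Fin d → F)),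
    ∀ X : Set (Fin r), Module.finrank F ↥(⨆ i ∈ X, V i) = ρ' X

/-- A discrete polymatroid is representable over `F` if its rank function is. -/
def DiscretePolymatroid.RepresentableOver {r : ℕ} (D : DiscretePolymatroid r)
    (F : Type) [Field F] : Prop :=
  RepFnOver r D.rho F


/-- An index coding problem with message index type `M`: a receiver `(x, H)` demands the
message `x` and has the set of messages `H` as side information. -/
structure IndexProblem (M : Type) where
  recv : Set (M × Set M)

/-- A linear index coding solution over `F` of length `c` and dimension `n`: each message is
a row vector of length `n` over `F`, the encoding map `f` is linear, and every receiver can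
recover its demanded message from its side information and `f(y)` by a linear decoding map. -/
def HasLinearIndexCode {M : Type} (P : IndexProblem M) (F : Type) [Field F]
    (n c : ℕ) : Prop :=
  ∃ f : ((M → Fin n → F) →ₗ[F] (Fin c → F)),
    ∀ p ∈ P.recv, ∃ ψ : ((↥p.2 → Fin n → F) × (Fin c → F)) →ₗ[F] (Fin n → F),
      ∀ y : M → Fin n → F, ψ (fun j => y j.1, f y) = y p.1

namespace DiscretePolymatroid

variable {r : ℕ} (D : DiscretePolymatroid r)

/-- A basis vector of a discrete polymatroid: a maximal element of the carrier. -/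
def IsBasisVec (b : Fin r → ℕ) : Prop :=
  b ∈ D.carrier ∧ ∀ u ∈ D.carrier, (∀ i, b i ≤ u i) → u = b

/-- An excluded vector of a discrete polymatroid. -/
def IsExcluded (u : Fin r → ℕ) : Prop :=
  (∀ i, u i ≤ D.rho {i}) ∧ u ∉ D.carrier

/-- A minimal excluded vector of a discrete polymatroid. -/
def IsMinExcluded (u : Fin r → ℕ) : Prop :=
  D.IsExcluded u ∧ ∀ v, D.IsExcluded v → (∀ i, v i ≤ u i) → v = u

/-- The message index type of the index coding problem `I^D(Z,R)`:
`Sum.inl j` is the message `x_j` (`j ∈ {1,…,rank D}`), and `Sum.inr ⟨i,p⟩` is the message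
`y_i^p` (`i ∈ {1,…,r}`, `p ∈ {1,…,ρ({i})}`). -/
@[reducible] noncomputable def Msg : Type :=
  Fin D.rank ⊕ (Σ i : Fin r, Fin (D.rho {i}))

/-- The number of elements of a subset `T` of `Y` lying in `ζ_l = {y_l^1,…,y_l^{ρ({l})}}`. -/
noncomputable def sliceCard (T : Set (Σ i : Fin r, Fin (D.rho {i}))) (l : Fin r) : ℕ :=
  {p : Fin (D.rho {l}) | (⟨l, p⟩ : Σ i : Fin r, Fin (D.rho {i})) ∈ T}.ncard

/-- The index coding problem `I^D(Z,R)` constructed from the discrete polymatroid `D`,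
with receiver set `R = R1 ∪ R2 ∪ R3`. -/
noncomputable def indexProblem : IndexProblem D.Msg where
  recv :=
    -- R1
    {pr | ∃ b : Fin r → ℕ, D.IsBasisVec b ∧ ∃ j : Fin D.rank,
        ∃ T : Set (Σ i : Fin r, Fin (D.rho {i})),
          (∀ l : Fin r, D.sliceCard T l = b l) ∧
          pr = (Sum.inl j, Sum.inr '' T)} ∪
    -- R2
    {pr | ∃ c : Fin r → ℕ, D.IsMinExcluded c ∧ ∃ j : Fin r, c j ≠ 0 ∧
        ∃ p : Fin (D.rho {j}), ∃ T : Set (Σ i : Fin r, Fin (D.rho {i})),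
          (∀ l : Fin r, l ≠ j → D.sliceCard T l = c l) ∧
          D.sliceCard T j = c j - 1 ∧
          (⟨j, p⟩ : Σ i : Fin r, Fin (D.rho {i})) ∉ T ∧
          pr = (Sum.inr ⟨j, p⟩, Sum.inr '' T)} ∪
    -- R3
    {pr | ∃ (i : Fin r) (p : Fin (D.rho {i})),
        pr = (Sum.inr ⟨i, p⟩, Set.range Sum.inl)}

/-- `M(I^D(Z,R)) = ∑_{i=1}^r ρ({i})`: a perfect solution of dimension `n` has length
`n * indexCodeLen`. -/
noncomputable def indexCodeLen : ℕ := ∑ i : Fin r, D.rho {i}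

/-- The bound `N(D)` on the field size. -/
noncomputable def Nbound : ℕ :=
  1 + Finset.univ.sup fun i : Fin r =>
    ∑ b ∈ D.finite.toFinset.filter (fun b => D.IsBasisVec b ∧ 0 < b i),
      Nat.choose (D.rho {i}) (b i - 1) *
        ∏ j ∈ (Finset.univ.filter fun j : Fin r => b j ≠ 0).erase i,
          Nat.choose (D.rho {j}) (b j)

end DiscretePolymatroid

section LinearAlgebra

theorem span_image_insert {ι K M : Type*} [Field K] [AddCommGroup M] [Module K M]
    (a : ι → M) (i : ι) (T : Set ι) :
    Submodule.span K (a '' insert i T) =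
      Submodule.span K {a i} ⊔ Submodule.span K (a '' T) := by
  rw [Set.image_insert_eq, Submodule.span_insert]

/-- Moving a vector outside of the span of a set of vectors does not lower the rank. -/
theorem finrank_span_insert_le_of_notMem {K M : Type*} [Field K] [AddCommGroup M] [Module K M]
    [FiniteDimensional K M] (W : Submodule K M) (x y : M) (h : x ∉ W → y ∉ W) :
    Module.finrank K ↥(Submodule.span K {x} ⊔ W) ≤
      Module.finrank K ↥(Submodule.span K {y} ⊔ W) := by
  by_cases hx : x ∈ W
  · have : Submodule.span K {x} ⊔ W = W := by simpa using hx
    rw [this]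
    exact Submodule.finrank_mono le_sup_right
  · have hlt : W < Submodule.span K {y} ⊔ W := by
      refine lt_of_le_of_ne le_sup_right fun he => h hx ?_
      rw [he]
      exact Submodule.mem_sup_left (Submodule.mem_span_singleton_self y)
    have h1 := Submodule.finrank_lt_finrank_of_lt hlt
    have h2 := Submodule.finrank_add_le_finrank_add_finrank (Submodule.span K {x}) W
    have h3 : Module.finrank K ↥(Submodule.span K {x}) ≤ 1 := by
      simpa using finrank_span_le_card (R := K) ({x} : Set M)
    omega

/-- Over a sufficiently large finite field, one can choose a vector in each subspace of a finite
family in general position: a chosen vector lies in the span of others only if its whole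
subspace does. -/
theorem exists_generalPosition {ι K M : Type*} [Fintype ι] [Field K] [Finite K]
    [AddCommGroup M] [Module K M] [FiniteDimensional K M] (V : ι → Submodule K M)
    (hK : 2 ^ Fintype.card ι + 1 < Nat.card K) :
    ∃ a : ι → M, (∀ i, a i ∈ V i) ∧ ∀ (i : ι) (T : Set ι), i ∉ T →
      a i ∈ Submodule.span K (a '' T) → V i ≤ Submodule.span K (a '' T) := by
  have : Finite M := Module.finite_of_finite K
  obtain ⟨a, ha, hmax⟩ := Set.exists_max_image {a : ι → M | ∀ i, a i ∈ V i}
    (fun a => ∑ S : Finset ι, Module.finrank K ↥(Submodule.span K (a '' (S : Set ι))))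
    (Set.toFinite _) ⟨0, fun i => (V i).zero_mem⟩
  refine ⟨a, ha, fun i T hiT hspan => ?_⟩
  by_contra hV
  obtain ⟨v, hv, hvT⟩ := Set.not_subset.1 hV
  let bad : Finset ι → Set K := fun S =>
    {l | a i ∉ Submodule.span K (a '' ((S : Set ι) \ {i})) ∧
      a i + l • v ∈ Submodule.span K (a '' ((S : Set ι) \ {i}))}
  have hbad : ∀ S, (bad S).Subsingleton := by
    intro S l hl m hm
    by_contra hne
    have h1 : (l - m) • v ∈ Submodule.span K (a '' ((S : Set ι) \ {i})) := by
      have := Submodule.sub_mem _ hl.2 hm.2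
      rwa [add_sub_add_left_eq_sub, ← sub_smul] at this
    rw [Submodule.smul_mem_iff _ (sub_ne_zero.2 hne)] at h1
    refine hl.1 ?_
    have := Submodule.sub_mem _ hl.2 (Submodule.smul_mem _ l h1)
    simpa using this
  obtain ⟨l, hl0, hl⟩ : ∃ l : K, l ≠ 0 ∧ ∀ S, l ∉ bad S := by
    by_contra! hcon
    have hcov : (Set.univ : Set K) ⊆ {0} ∪ ⋃ S ∈ (Finset.univ : Finset (Finset ι)), bad S := by
      intro l _
      by_cases h0 : l = 0
      · exact Or.inl h0
      · obtain ⟨S, hS⟩ := hcon l h0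
        exact Or.inr (by simpa using ⟨S, hS⟩)
    have h1 := Set.ncard_le_ncard hcov (Set.toFinite _)
    have h2 := Set.ncard_union_le ({0} : Set K)
      (⋃ S ∈ (Finset.univ : Finset (Finset ι)), bad S)
    have h3 := Finset.set_ncard_biUnion_le (Finset.univ : Finset (Finset ι)) bad
    have h4 : ∑ S : Finset ι, (bad S).ncard ≤ ∑ _S : Finset ι, 1 :=
      Finset.sum_le_sum fun S _ => (Set.ncard_le_one (Set.toFinite _)).2 fun x hx y hy =>
        hbad S hx hy
    simp only [Finset.sum_const, Finset.card_univ, Fintype.card_finset, smul_eq_mul, mul_one] at h4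
    rw [Set.ncard_univ] at h1
    rw [Set.ncard_singleton] at h2
    omega
  set b := Function.update a i (a i + l • v) with hb
  have hbV : ∀ k, b k ∈ V k := by
    intro k
    by_cases hk : k = i
    · subst hk
      simpa [hb] using (V k).add_mem (ha k) ((V k).smul_mem l hv)
    · simpa [hb, hk] using ha k
  have himg : ∀ S : Set ι, i ∉ S → b '' S = a '' S := fun S hS =>
    Set.image_congr fun k hk => by
      have hki : k ≠ i := by rintro rfl; exact hS hk
      simp [hb, hki]
  have hai : b i = a i + l • v := by simp [hb]
  refine absurd (hmax b hbV) (not_le.2 (Finset.sum_lt_sum (fun S _ => ?_)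
    ⟨(Set.toFinite (insert i T)).toFinset, Finset.mem_univ _, ?_⟩))
  · by_cases hiS : i ∈ S
    · have hS : (S : Set ι) = insert i ((S : Set ι) \ {i}) := by
        simp [hiS]
      rw [hS, span_image_insert, span_image_insert, himg _ (by simp), hai]
      exact finrank_span_insert_le_of_notMem _ _ _ fun h h' => hl S ⟨h, h'⟩
    · rw [himg _ (by simpa using hiS)]
  · rw [Set.Finite.coe_toFinset, span_image_insert, span_image_insert, himg _ hiT, hai]
    have h1 : Submodule.span K {a i} ⊔ Submodule.span K (a '' T) = Submodule.span K (a '' T) := by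
      simpa using hspan
    rw [h1]
    refine Submodule.finrank_lt_finrank_of_lt (lt_of_le_of_ne le_sup_right fun he => hvT ?_)
    have h2 : a i + l • v ∈ Submodule.span K (a '' T) := by
      rw [he]
      exact Submodule.mem_sup_left (Submodule.mem_span_singleton_self _)
    have h3 := Submodule.sub_mem _ h2 hspan
    rw [add_sub_cancel_left, Submodule.smul_mem_iff _ hl0] at h3
    exact h3

/-- Rado's theorem for vectors in general position. -/
theorem linearIndepOn_of_generalPosition {ι κ K M : Type*} [Finite ι] [Field K]
    [AddCommGroup M] [Module K M] [FiniteDimensional K M] (V : κ → Submodule K M) (π : ι → κ)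
    (a : ι → M) (hgen : ∀ (i : ι) (T : Set ι), i ∉ T →
      a i ∈ Submodule.span K (a '' T) → V (π i) ≤ Submodule.span K (a '' T))
    (T : Set ι)
    (hT : ∀ X : Set κ, (T ∩ π ⁻¹' X).ncard ≤ Module.finrank K ↥(⨆ k ∈ X, V k)) :
    LinearIndepOn K a T := by
  by_contra hdep
  obtain ⟨C, hCT, hC⟩ := exists_minimal_le_of_wellFoundedLT
    (fun S : Set ι => ¬ LinearIndepOn K a S) T hdep
  have hmem : ∀ t ∈ C, a t ∈ Submodule.span K (a '' (C \ {t})) := by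
    intro t ht
    by_contra hnot
    have hind : LinearIndepOn K a (C \ {t}) := by
      by_contra h
      exact (hC.2 h Set.sdiff_subset ht).2 rfl
    have := (linearIndepOn_insert (a := t) (by simp)).2 ⟨hind, hnot⟩
    rw [Set.insert_sdiff_singleton, Set.insert_eq_of_mem ht] at this
    exact hC.1 this
  obtain ⟨t, ht⟩ : C.Nonempty := by
    rw [Set.nonempty_iff_ne_empty]
    rintro rfl
    exact hC.1 (linearIndepOn_empty K a)
  have hle : (⨆ k ∈ π '' C, V k) ≤ Submodule.span K (a '' (C \ {t})) := by
    have hspan : Submodule.span K (a '' C) ≤ Submodule.span K (a '' (C \ {t})) := by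
      rw [Submodule.span_le]
      rintro _ ⟨s, hs, rfl⟩
      by_cases hst : s = t
      · exact hst ▸ hmem t ht
      · exact Submodule.subset_span ⟨s, ⟨hs, hst⟩, rfl⟩
    refine iSup₂_le ?_
    rintro _ ⟨s, hs, rfl⟩
    exact ((hgen s _ (by simp) (hmem s hs)).trans
      (Submodule.span_mono (Set.image_mono Set.sdiff_subset))).trans hspan
  have h1 := Submodule.finrank_mono hle
  have h2 : Module.finrank K ↥(Submodule.span K (a '' (C \ {t}))) ≤ (C \ {t}).ncard := by
    have := Fintype.ofFinite ↥(a '' (C \ {t}))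
    refine (finrank_span_le_card _).trans ?_
    rw [← Set.ncard_eq_toFinset_card']
    exact Set.ncard_image_le (Set.toFinite _)
  have h3 : C.ncard ≤ (T ∩ π ⁻¹' (π '' C)).ncard :=
    Set.ncard_le_ncard (fun s hs => ⟨hCT hs, s, hs, rfl⟩) (Set.toFinite _)
  have h4 := hT (π '' C)
  have h5 := Set.ncard_sdiff_singleton_lt_of_mem ht (Set.toFinite _)
  omega

theorem Submodule.baseChange_biSup {F K M κ : Type*} [Field F] [Field K] [Algebra F K]
    [AddCommGroup M] [Module F M] (V : κ → Submodule F M) (X : Set κ) :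
    (⨆ k ∈ X, V k).baseChange K = ⨆ k ∈ X, (V k).baseChange K := by
  refine le_antisymm ?_ (iSup₂_le fun k hk =>
    Submodule.baseChange_mono _ (le_iSup₂_of_le k hk le_rfl))
  rw [Submodule.baseChange_eq_span, Submodule.span_le]
  have : (⨆ k ∈ X, V k) ≤
      ((⨆ k ∈ X, (V k).baseChange K).restrictScalars F).comap (TensorProduct.mk F K M 1) :=
    iSup₂_le fun k hk m hm => by
      have h : (V k).baseChange K ≤ ⨆ k ∈ X, (V k).baseChange K := le_iSup₂_of_le k hk le_rfl
      exact h (Submodule.tmul_mem_baseChange_of_mem 1 hm)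
  rintro _ ⟨m, hm, rfl⟩
  exact this hm

theorem Submodule.finrank_baseChange_eq {F K M : Type*} [Field F] [Field K] [Algebra F K]
    [AddCommGroup M] [Module F M] (W : Submodule F M) :
    Module.finrank K ↥(W.baseChange K) = Module.finrank F ↥W := by
  have hinj : Function.Injective (W.subtype.baseChange K) :=
    Module.Flat.lTensor_preserves_injective_linearMap W.subtype W.injective_subtype
  rw [Submodule.baseChange, LinearMap.finrank_range_of_inj hinj, Module.finrank_baseChange]

/-- A finite field has finite extensions of arbitrarily large cardinality. -/
theorem exists_finite_extension_card_gt (F : Type) [Field F] [Finite F] (n : ℕ) :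
    ∃ (K : Type) (_ : Field K) (_ : Algebra F K), Finite K ∧ n < Nat.card K := by
  obtain ⟨p, hp⟩ := CharP.exists F
  have : Fact p.Prime := ⟨CharP.char_is_prime F p⟩
  refine ⟨FiniteField.Extension F p (n + 1), inferInstance, inferInstance, inferInstance, ?_⟩
  rw [FiniteField.natCard_extension]
  exact (Nat.lt_succ_self n).trans (Nat.lt_pow_self Finite.one_lt_card)

/-- A rank function is represented by subspaces of `F^d` as soon as it is represented by
subspaces of some finite-dimensional space. -/
theorem RepFnOver.of_finiteDimensional {r : ℕ} {ρ : Set (Fin r) → ℕ} {F M : Type} [Field F]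
    [AddCommGroup M] [Module F M] [FiniteDimensional F M] (V : Fin r → Submodule F M)
    (hV : ∀ X : Set (Fin r), Module.finrank F ↥(⨆ i ∈ X, V i) = ρ X) : RepFnOver r ρ F := by
  let e := (Module.finBasis F M).equivFun
  refine ⟨_, fun i => (V i).map e.toLinearMap, fun X => ?_⟩
  have h : (⨆ i ∈ X, V i).map e.toLinearMap = ⨆ i ∈ X, (V i).map e.toLinearMap := by
    simp only [Submodule.map_iSup]
  rw [← hV X, ← h]
  exact e.finrank_map_eq _

end LinearAlgebra

namespace DiscretePolymatroid

variable {r : ℕ} (D : DiscretePolymatroid r)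

theorem setSum_le_rho {u : Fin r → ℕ} (hu : u ∈ D.carrier) (X : Set (Fin r)) :
    setSum u X ≤ D.rho X :=
  Finset.le_sup (f := fun u => setSum u X) (D.finite.mem_toFinset.2 hu)

theorem setSum_singleton (u : Fin r → ℕ) (i : Fin r) : setSum u {i} = u i := by
  simp [setSum, Finset.filter_eq']

theorem setSum_univ (u : Fin r → ℕ) : setSum u Set.univ = ∑ i, u i := by
  simp [setSum]

theorem setSum_eq_sum_of_support_subset {u : Fin r → ℕ} {X : Set (Fin r)}
    (h : ∀ i, i ∉ X → u i = 0) : setSum u X = ∑ i, u i := by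
  rw [setSum, Finset.sum_filter]
  exact Finset.sum_congr rfl fun i _ => by
    split_ifs with hi
    · rfl
    · exact (h i hi).symm

theorem le_rho_singleton {u : Fin r → ℕ} (hu : u ∈ D.carrier) (i : Fin r) :
    u i ≤ D.rho {i} := by
  simpa [setSum_singleton] using D.setSum_le_rho hu {i}

theorem exists_sum_eq_rho (X : Set (Fin r)) :
    ∃ u ∈ D.carrier, (∀ i, i ∉ X → u i = 0) ∧ ∑ i, u i = D.rho X := by
  obtain ⟨u, hu, he⟩ := Finset.exists_mem_eq_sup D.finite.toFinset
    (by simpa using D.nonempty) (fun u => setSum u X)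
  refine ⟨fun i => if i ∈ X then u i else 0, D.lower u (by simpa using hu) _ ?_, ?_, ?_⟩
  · intro i
    split_ifs <;> simp
  · intro i hi
    simp [hi]
  · rw [rho, he, setSum, Finset.sum_filter]

theorem exists_isBasisVec_ge {u : Fin r → ℕ} (hu : u ∈ D.carrier) :
    ∃ b, D.IsBasisVec b ∧ u ≤ b := by
  obtain ⟨b, hub, hb⟩ := D.finite.exists_le_maximal hu
  exact ⟨b, ⟨hb.1, fun v hv hbv => le_antisymm (hb.2 hv hbv) hbv⟩, hub⟩

variable {D} in
theorem IsBasisVec.sum_eq_rank {b : Fin r → ℕ} (hb : D.IsBasisVec b) :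
    ∑ i, b i = D.rank := by
  obtain ⟨u, hu, -, hsum⟩ := D.exists_sum_eq_rho Set.univ
  refine le_antisymm ?_ ?_
  · simpa [setSum_univ, rank] using D.setSum_le_rho hb.1 Set.univ
  · by_contra! hlt
    rw [rank, ← hsum] at hlt
    obtain ⟨w, hw, hle, hne, -⟩ := D.exchange b hb.1 u hu hlt
    exact hne (hb.2 w hw hle).symm

theorem exists_isMinExcluded_le {u : Fin r → ℕ} (hu : D.IsExcluded u) :
    ∃ c, D.IsMinExcluded c ∧ c ≤ u := by
  obtain ⟨c, hcu, hc⟩ := exists_minimal_le_of_wellFoundedLT D.IsExcluded u hu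
  exact ⟨c, ⟨hc.1, fun v hv hvc => le_antisymm hvc (hc.2 hv hvc)⟩, hcu⟩

variable {D} in
theorem IsMinExcluded.mem_of_le_of_ne {c v : Fin r → ℕ} (hc : D.IsMinExcluded c) (hvc : v ≤ c)
    (hne : v ≠ c) : v ∈ D.carrier := by
  by_contra hv
  exact hne (hc.2 v ⟨fun i => (hvc i).trans (hc.1.1 i), hv⟩ hvc)

theorem update_pred_lt {c : Fin r → ℕ} {j : Fin r} (hj : c j ≠ 0) :
    Function.update c j (c j - 1) ≤ c ∧ Function.update c j (c j - 1) ≠ c := by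
  refine ⟨fun i => ?_, fun h => ?_⟩
  · by_cases hi : i = j
    · subst hi; simp
    · simp [hi]
  · have := congrFun h j
    simp at this
    omega

theorem sum_update_pred {c : Fin r → ℕ} {j : Fin r} (hj : c j ≠ 0) :
    ∑ i, Function.update c j (c j - 1) i + 1 = ∑ i, c i := by
  rw [Finset.sum_update_of_mem (Finset.mem_univ j),
    ← Finset.add_sum_erase _ c (Finset.mem_univ j), Finset.sdiff_singleton_eq_erase]
  omega

variable {D} in
/-- The support of a minimal excluded vector `c` has rank less than the component sum of `c`. -/
theorem IsMinExcluded.rho_support_lt {c : Fin r → ℕ} (hc : D.IsMinExcluded c) :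
    D.rho {i | c i ≠ 0} < ∑ i, c i := by
  obtain ⟨v, hv, hsupp, hsum⟩ := D.exists_sum_eq_rho {i | c i ≠ 0}
  rw [← hsum]
  by_contra! hle
  have hpred : ∀ j, c j ≠ 0 → Function.update c j (c j - 1) ∈ D.carrier := fun j hj =>
    hc.mem_of_le_of_ne (update_pred_lt hj).1 (update_pred_lt hj).2
  obtain ⟨l, hl⟩ : ∃ l, v l < c l := by
    by_contra! h
    exact hc.1.2 (D.lower v hv c h)
  have hl0 : c l ≠ 0 := by omega
  obtain ⟨w, hw, hcw, hne, hwv⟩ := D.exchange _ (hpred l hl0) v hv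
    (by have := sum_update_pred hl0; omega)
  obtain ⟨m, hm⟩ : ∃ m, Function.update c l (c l - 1) m < w m := by
    by_contra! h
    exact hne (funext fun i => le_antisymm (hcw i) (h i))
  have hml : m ≠ l := by
    rintro rfl
    have := hwv m
    simp only [Function.update_self] at this hm
    omega
  have hcm : c m < w m := by simpa [hml] using hm
  have hm0 : c m ≠ 0 := by
    intro h0
    have h1 := hwv m
    have h2 := hsupp m (by simpa using h0)
    simp only [ne_eq, hml, not_false_eq_true, Function.update_of_ne] at h1
    omega
  let x := Function.update (Function.update c l (c l - 1)) m (c m + 1)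
  have hxD : x ∈ D.carrier := D.lower w hw x fun i => by
    by_cases hi : i = m
    · subst hi; simpa [x] using hcm
    · simpa [x, hi] using hcw i
  have hxsum : ∑ i, x i = ∑ i, c i := by
    have h1 := sum_update_pred hl0
    have h2 : ∑ i, x i = ∑ i, Function.update c l (c l - 1) i + 1 := by
      rw [Finset.sum_update_of_mem (Finset.mem_univ m),
        ← Finset.add_sum_erase _ (Function.update c l (c l - 1)) (Finset.mem_univ m),
        Finset.sdiff_singleton_eq_erase, Function.update_of_ne hml]
      omega
    omega
  obtain ⟨z, hz, hcz, hnez, hzx⟩ := D.exchange _ (hpred m hm0) x hxD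
    (by have := sum_update_pred hm0; omega)
  obtain ⟨s, hs⟩ : ∃ s, Function.update c m (c m - 1) s < z s := by
    by_contra! h
    exact hnez (funext fun i => le_antisymm (hcz i) (h i))
  have hsm : s = m := by
    by_contra hsm
    have h1 := hzx s
    by_cases hsl : s = l
    · subst hsl
      simp only [x, Function.update_of_ne hsm, Function.update_self] at h1 hs
      omega
    · simp only [x, Function.update_of_ne hsm, Function.update_of_ne hsl] at h1 hs
      omega
  subst hsm
  refine hc.1.2 (D.lower z hz c fun i => ?_)
  by_cases hi : i = s
  · subst hi
    simp only [Function.update_self] at hs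
    omega
  · simpa [hi] using hcz i

/-- The set of messages `y_i^p` whose `i`-th slice consists of the first `u i` messages. -/
def initialMsgs (u : Fin r → ℕ) : Set (Σ i : Fin r, Fin (D.rho {i})) :=
  {t | t.2.val < u t.1}

theorem sliceCard_initialMsgs {u : Fin r → ℕ} {l : Fin r} (hu : u l ≤ D.rho {l}) :
    D.sliceCard (D.initialMsgs u) l = u l := by
  have : {p : Fin (D.rho {l}) | (⟨l, p⟩ : Σ i : Fin r, Fin (D.rho {i})) ∈ D.initialMsgs u} =
      Set.range (Fin.castLE hu) := by
    ext p
    simp only [initialMsgs, Set.mem_ofPred_eq, Set.mem_range]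
    exact ⟨fun h => ⟨⟨p, h⟩, rfl⟩, by rintro ⟨q, rfl⟩; exact q.2⟩
  rw [sliceCard, this, ← Set.image_univ,
    Set.ncard_image_of_injective _ (Fin.castLE_injective hu), Set.ncard_univ, Nat.card_fin]

theorem ncard_inter_preimage_fst (T : Set (Σ i : Fin r, Fin (D.rho {i}))) (X : Set (Fin r)) :
    (T ∩ Sigma.fst ⁻¹' X).ncard = setSum (D.sliceCard T) X := by
  have : T ∩ Sigma.fst ⁻¹' X = ((Finset.univ.filter (· ∈ X)).sigma fun i =>
      Finset.univ.filter fun p => (⟨i, p⟩ : Σ i : Fin r, Fin (D.rho {i})) ∈ T : Finset _) := by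
    ext ⟨i, p⟩
    simp [and_comm]
  rw [this, Set.ncard_coe_finset, Finset.card_sigma, setSum]
  refine Finset.sum_congr rfl fun i _ => ?_
  rw [sliceCard, ← Set.ncard_coe_finset]
  simp

theorem ncard_eq_sum_sliceCard (T : Set (Σ i : Fin r, Fin (D.rho {i}))) :
    T.ncard = ∑ i, D.sliceCard T i := by
  simpa [setSum_univ] using D.ncard_inter_preimage_fst T Set.univ

end DiscretePolymatroid

theorem LinearMap.exists_comp_eq_of_ker_le {K V W U : Type*} [Field K] [AddCommGroup V]
    [AddCommGroup W] [AddCommGroup U] [Module K V] [Module K W] [Module K U]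
    (g : V →ₗ[K] W) (h : V →ₗ[K] U) (hle : ∀ v, g v = 0 → h v = 0) :
    ∃ ψ : W →ₗ[K] U, ∀ v, ψ (g v) = h v := by
  obtain ⟨s, hs⟩ := LinearMap.exists_leftInverse_of_injective
    ((LinearMap.ker g).liftQ g le_rfl) (Submodule.ker_liftQ_eq_bot _ _ _ le_rfl)
  refine ⟨((LinearMap.ker g).liftQ h fun v hv =>
    LinearMap.mem_ker.2 (hle v (LinearMap.mem_ker.1 hv))) ∘ₗ s, fun v => ?_⟩
  have := LinearMap.congr_fun hs ((LinearMap.ker g).mkQ v)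
  simp only [LinearMap.comp_apply, Submodule.mkQ_apply, Submodule.liftQ_apply,
    LinearMap.id_apply] at this ⊢
  rw [this]
  exact Submodule.liftQ_apply _ _ _

/-- A scalar linear code exists if and only if some linear map into a space of dimension `c`
determines the demand of each receiver from its side information. -/
theorem hasLinearIndexCode_one_iff {M ι : Type} [Fintype ι] (P : IndexProblem M) (F : Type)
    [Field F] {c : ℕ} (hc : Fintype.card ι = c) :
    HasLinearIndexCode P F 1 c ↔ ∃ f : (M → F) →ₗ[F] (ι → F), ∀ p ∈ P.recv,
      ∀ y : M → F, (∀ m ∈ p.2, y m = 0) → f y = 0 → y p.1 = 0 := by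
  let e : (Fin c → F) ≃ₗ[F] (ι → F) := LinearEquiv.funCongrLeft F F (Fintype.equivFinOfCardEq hc)
  constructor
  · rintro ⟨f, hf⟩
    let s : (M → F) →ₗ[F] (M → Fin 1 → F) :=
      LinearMap.pi fun m => LinearMap.pi fun _ => LinearMap.proj m
    refine ⟨e.toLinearMap ∘ₗ f ∘ₗ s, fun p hp y hy hfy => ?_⟩
    obtain ⟨ψ, hψ⟩ := hf p hp
    have h0 : f (s y) = 0 := by simpa using hfy
    have h1 : (fun j : ↥p.2 => s y j.1) = 0 := by
      ext j k
      exact hy j.1 j.2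
    have h2 := hψ (s y)
    rw [h0, h1] at h2
    have h3 : s y p.1 = 0 := by rw [← h2]; exact map_zero ψ
    exact congrFun h3 0
  · rintro ⟨f, hf⟩
    let s : (M → Fin 1 → F) →ₗ[F] (M → F) :=
      LinearMap.pi fun m => LinearMap.proj 0 ∘ₗ LinearMap.proj m
    refine ⟨e.symm.toLinearMap ∘ₗ f ∘ₗ s, fun p hp => ?_⟩
    refine LinearMap.exists_comp_eq_of_ker_le
      (LinearMap.prod (LinearMap.pi fun j : ↥p.2 => LinearMap.proj j.1)
        (e.symm.toLinearMap ∘ₗ f ∘ₗ s)) (LinearMap.proj p.1) fun y hy => ?_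
    obtain ⟨h1, h2⟩ := Prod.mk.inj hy
    have h3 : f (s y) = 0 := by simpa using h2
    ext k
    rw [Subsingleton.elim k 0]
    exact hf p hp (s y) (fun m hm => congrFun (congrFun h1 ⟨m, hm⟩) 0) h3

namespace DiscretePolymatroid

variable {r : ℕ} (D : DiscretePolymatroid r)

theorem card_msgs : Fintype.card (Σ i : Fin r, Fin (D.rho {i})) = 1 * D.indexCodeLen := by
  simp [indexCodeLen]

/-- Normal form of the scalar perfect linear codes of `I^D(Z,R)`: after a change of coordinates
the transmitted symbols are `φ_t(x) + y_t`. -/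
theorem hasLinearIndexCode_iff_exists_functionals (F : Type) [Field F] :
    HasLinearIndexCode D.indexProblem F 1 (1 * D.indexCodeLen) ↔
      ∃ φ : (Σ i : Fin r, Fin (D.rho {i})) → Module.Dual F (Fin D.rank → F),
        (∀ (b : Fin r → ℕ) (T : Set (Σ i : Fin r, Fin (D.rho {i}))), D.IsBasisVec b →
          (∀ l, D.sliceCard T l = b l) → ∀ x, (∀ t ∈ T, φ t x = 0) → x = 0) ∧
        (∀ (c : Fin r → ℕ) (t : Σ i : Fin r, Fin (D.rho {i}))
          (T : Set (Σ i : Fin r, Fin (D.rho {i}))), D.IsMinExcluded c → c t.1 ≠ 0 →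
          (∀ l, D.sliceCard T l = Function.update c t.1 (c t.1 - 1) l) → t ∉ T →
          ∀ x, (∀ s ∈ T, φ s x = 0) → φ t x = 0) := by
  rw [hasLinearIndexCode_one_iff _ _ D.card_msgs]
  constructor
  · rintro ⟨f, hf⟩
    let inx : (Fin D.rank → F) →ₗ[F] (D.Msg → F) :=
      LinearMap.pi (Sum.elim (fun j => LinearMap.proj j) (fun _ => 0))
    let iny : ((Σ i : Fin r, Fin (D.rho {i})) → F) →ₗ[F] (D.Msg → F) :=
      LinearMap.pi (Sum.elim (fun _ => 0) (fun t => LinearMap.proj t))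
    have hinj : Function.Injective (f ∘ₗ iny) := by
      rw [injective_iff_map_eq_zero]
      intro y hy
      ext ⟨i, p⟩
      exact hf (Sum.inr ⟨i, p⟩, Set.range Sum.inl) (Or.inr ⟨i, p, rfl⟩) (iny y)
        (by rintro _ ⟨j, rfl⟩; rfl) hy
    let B := LinearEquiv.ofInjectiveEndo (f ∘ₗ iny) hinj
    let Φ := B.symm.toLinearMap ∘ₗ f ∘ₗ inx
    have key : ∀ x, f (inx x - iny (Φ x)) = 0 := by
      intro x
      have : f (iny (Φ x)) = f (inx x) := B.apply_symm_apply (f (inx x))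
      rw [map_sub, this, sub_self]
    refine ⟨fun t => LinearMap.proj t ∘ₗ Φ, ?_, ?_⟩
    · intro b T hb hT x hx
      ext j
      have := hf (Sum.inl j, Sum.inr '' T) (Or.inl (Or.inl ⟨b, hb, j, T, hT, rfl⟩))
        (inx x - iny (Φ x)) (by
          rintro _ ⟨t, ht, rfl⟩
          simpa [inx, iny] using hx t ht) (key x)
      simpa [inx, iny] using this
    · rintro c ⟨j, p⟩ T hc hcj hT ht x hx
      have := hf (Sum.inr ⟨j, p⟩, Sum.inr '' T)
        (Or.inl (Or.inr ⟨c, hc, j, hcj, p, T, fun l hl => by simpa [hl] using hT l,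
          by simpa using hT j, ht, rfl⟩))
        (inx x - iny (Φ x)) (by
          rintro _ ⟨t, ht, rfl⟩
          simpa [inx, iny] using hx t ht) (key x)
      simpa [inx, iny] using this
  · rintro ⟨φ, h1, h2⟩
    let px : (D.Msg → F) →ₗ[F] (Fin D.rank → F) := LinearMap.funLeft F F Sum.inl
    refine ⟨LinearMap.pi fun t => φ t ∘ₗ px + LinearMap.proj (Sum.inr t), ?_⟩
    rintro _ ((⟨b, hb, j, T, hT, rfl⟩ | ⟨c, hc, j, hcj, p, T, hT, hTj, hp, rfl⟩) | ⟨i, p, rfl⟩)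
      y hy hfy
    all_goals
      have hfy' : ∀ t, φ t (px y) + y (Sum.inr t) = 0 := fun t => congrFun hfy t
    · have hx := h1 b T hb hT (px y) fun t ht => by
        have h := hfy' t
        rwa [hy _ ⟨t, ht, rfl⟩, add_zero] at h
      exact congrFun hx j
    · have hx := h2 c ⟨j, p⟩ T hc hcj (fun l => by
          by_cases hl : l = j
          · subst hl; simpa using hTj
          · simpa [hl] using hT l hl) hp (px y) fun t ht => by
        have h := hfy' t
        rwa [hy _ ⟨t, ht, rfl⟩, add_zero] at h
      have h := hfy' ⟨j, p⟩
      rwa [hx, zero_add] at h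
    · have hx : px y = 0 := by
        ext j
        exact hy _ ⟨j, rfl⟩
      have h := hfy' ⟨i, p⟩
      rwa [hx, map_zero, zero_add] at h

theorem mem_span_image_of_forall_eq_zero {ι F E : Type*} [Finite ι] [Field F] [AddCommGroup E]
    [Module F E] (φ : ι → Module.Dual F E) (T : Set ι) (ψ : Module.Dual F E)
    (h : ∀ x, (∀ t ∈ T, φ t x = 0) → ψ x = 0) : ψ ∈ Submodule.span F (φ '' T) := by
  have := mem_span_of_iInf_ker_le_ker (L := fun t : T => φ t) (K := ψ) fun x hx => by
    simp only [Submodule.mem_iInf, LinearMap.mem_ker, Subtype.forall] at hx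
    exact h x hx
  rwa [Set.image_eq_range]

theorem representable_of_hasLinearIndexCode (F : Type) [Field F]
    (h : HasLinearIndexCode D.indexProblem F 1 (1 * D.indexCodeLen)) : RepFnOver r D.rho F := by
  obtain ⟨φ, h1, h2⟩ := (D.hasLinearIndexCode_iff_exists_functionals F).1 h
  let V : Fin r → Submodule F (Module.Dual F (Fin D.rank → F)) := fun i =>
    Submodule.span F (Set.range fun p => φ ⟨i, p⟩)
  have hφV : ∀ t, φ t ∈ V t.1 := fun t => Submodule.subset_span ⟨t.2, rfl⟩
  refine RepFnOver.of_finiteDimensional V fun X => ?_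
  obtain ⟨u, hu, hsupp, hsum⟩ := D.exists_sum_eq_rho X
  refine le_antisymm ?_ ?_
  · have hle : (⨆ i ∈ X, V i) ≤ Submodule.span F (φ '' D.initialMsgs u) := by
      refine iSup₂_le fun j hj => Submodule.span_le.2 ?_
      rintro _ ⟨p, rfl⟩
      by_cases hp : p.val < u j
      · exact Submodule.subset_span ⟨⟨j, p⟩, hp, rfl⟩
      set w := Function.update u j (u j + 1) with hw
      have hwj : w j = u j + 1 := by simp [hw]
      have hwne : ∀ i, i ≠ j → w i = u i := fun i hi => by simp [hw, hi]
      have hwsum : ∑ i, w i = ∑ i, u i + 1 := by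
        rw [hw, Finset.sum_update_of_mem (Finset.mem_univ j),
          ← Finset.add_sum_erase _ u (Finset.mem_univ j), Finset.sdiff_singleton_eq_erase]
        omega
      have hwex : D.IsExcluded w := by
        refine ⟨fun i => ?_, fun hmem => ?_⟩
        · by_cases hi : i = j
          · subst hi
            have := p.2
            omega
          · rw [hwne i hi]
            exact D.le_rho_singleton hu i
        · have hle := D.setSum_le_rho hmem X
          rw [setSum_eq_sum_of_support_subset, hwsum] at hle
          · omega
          · intro i hi
            rw [hwne i (by rintro rfl; exact hi hj), hsupp i hi]
      obtain ⟨c, hc, hcw⟩ := D.exists_isMinExcluded_le hwex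
      have hcj : c j = u j + 1 := by
        refine le_antisymm (hwj ▸ hcw j) ?_
        by_contra! hlt
        refine hc.1.2 (D.lower u hu c fun i => ?_)
        by_cases hi : i = j
        · subst hi; omega
        · exact hwne i hi ▸ hcw i
      have hv : ∀ i, Function.update c j (c j - 1) i ≤ u i := by
        intro i
        by_cases hi : i = j
        · subst hi; simp [hcj]
        · simpa [hi, hwne i hi] using hcw i
      refine Submodule.span_mono (Set.image_mono ?_) (mem_span_image_of_forall_eq_zero φ
        (D.initialMsgs (Function.update c j (c j - 1))) _ (h2 c ⟨j, p⟩ _ hc (by simp [hcj])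
          (fun l => D.sliceCard_initialMsgs ((hv l).trans (D.le_rho_singleton hu l))) ?_))
      · exact fun t ht => lt_of_lt_of_le ht (hv t.1)
      · exact fun hmem => hp (lt_of_lt_of_le hmem (hv j))
    refine (Submodule.finrank_mono hle).trans ?_
    have := Fintype.ofFinite ↥(φ '' D.initialMsgs u)
    refine (finrank_span_le_card _).trans ?_
    rw [← Set.ncard_eq_toFinset_card', ← hsum]
    refine (Set.ncard_image_le (Set.toFinite _)).trans (le_of_eq ?_)
    rw [D.ncard_eq_sum_sliceCard]
    exact Finset.sum_congr rfl fun i _ => D.sliceCard_initialMsgs (D.le_rho_singleton hu i)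
  · obtain ⟨b, hb, hub⟩ := D.exists_isBasisVec_ge hu
    have hslice : ∀ l, D.sliceCard (D.initialMsgs b) l = b l := fun l =>
      D.sliceCard_initialMsgs (D.le_rho_singleton hb.1 l)
    have hslice_u : ∀ l, D.sliceCard (D.initialMsgs u) l = u l := fun l =>
      D.sliceCard_initialMsgs (D.le_rho_singleton hu l)
    have hind : LinearIndepOn F φ (D.initialMsgs b) := by
      refine linearIndependent_of_top_le_span_of_card_le_finrank ?_ ?_
      · intro ψ _
        have := mem_span_image_of_forall_eq_zero φ (D.initialMsgs b) ψ fun x hx => by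
          rw [h1 b _ hb hslice x hx, map_zero]
        rwa [Set.image_eq_range] at this
      · rw [Subspace.dual_finrank_eq, Module.finrank_fin_fun, ← Nat.card_eq_fintype_card,
          Nat.card_coe_set_eq, D.ncard_eq_sum_sliceCard, ← hb.sum_eq_rank]
        exact (Finset.sum_congr rfl fun i _ => hslice i).le
    have hind_u : LinearIndependent F fun t : D.initialMsgs u => φ t :=
      hind.mono fun t ht => lt_of_lt_of_le ht (hub t.1)
    have hcard := finrank_span_eq_card hind_u
    rw [← Nat.card_eq_fintype_card, Nat.card_coe_set_eq, D.ncard_eq_sum_sliceCard,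
      Finset.sum_congr rfl fun i _ => hslice_u i, hsum] at hcard
    rw [← hcard]
    refine Submodule.finrank_mono (Submodule.span_le.2 ?_)
    rintro _ ⟨⟨t, ht⟩, rfl⟩
    have htX : t.1 ∈ X := by
      by_contra hX
      have h0 := hsupp _ hX
      have hlt : t.2.val < u t.1 := ht
      omega
    exact (le_iSup₂_of_le (f := fun i (_ : i ∈ X) => V i) t.1 htX le_rfl) (hφV t)

/-- A representation over a sufficiently large finite field yields a scalar perfect linear
code over the same field. -/
theorem hasLinearIndexCode_of_finrank_eq_rho {K M : Type} [Field K] [Finite K] [AddCommGroup M]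
    [Module K M] [FiniteDimensional K M] (V : Fin r → Submodule K M)
    (hV : ∀ X : Set (Fin r), Module.finrank K ↥(⨆ i ∈ X, V i) = D.rho X)
    (hK : 2 ^ Fintype.card (Σ i : Fin r, Fin (D.rho {i})) + 1 < Nat.card K) :
    HasLinearIndexCode D.indexProblem K 1 (1 * D.indexCodeLen) := by
  obtain ⟨a, haV, hgen⟩ := exists_generalPosition
    (fun t : Σ i : Fin r, Fin (D.rho {i}) => V t.1) hK
  have hindep : ∀ (u : Fin r → ℕ) (T : Set (Σ i : Fin r, Fin (D.rho {i}))), u ∈ D.carrier →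
      (∀ l, D.sliceCard T l = u l) → LinearIndepOn K a T := fun u T hu hT =>
    linearIndepOn_of_generalPosition V Sigma.fst a hgen T fun X => by
      rw [hV, D.ncard_inter_preimage_fst, funext hT]
      exact D.setSum_le_rho hu X
  let W := ⨆ i ∈ (Set.univ : Set (Fin r)), V i
  have haW : ∀ t, a t ∈ W := fun t =>
    (le_iSup₂_of_le (f := fun i (_ : i ∈ Set.univ) => V i) t.1 (Set.mem_univ _) le_rfl) (haV t)
  have hdim : Module.finrank K (Fin D.rank → K) = Module.finrank K (Module.Dual K W) := by
    rw [Subspace.dual_finrank_eq, hV, Module.finrank_fin_fun, rank]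
  let E := LinearEquiv.ofFinrankEq (Fin D.rank → K) (Module.Dual K W) hdim
  let aW : (Σ i : Fin r, Fin (D.rho {i})) → W := fun t => ⟨a t, haW t⟩
  have hindep' : ∀ T, LinearIndepOn K a T → LinearIndepOn K aW T := fun T hT =>
    LinearIndependent.of_comp W.subtype hT
  have hspan' : ∀ (T : Set (Σ i : Fin r, Fin (D.rho {i}))) (ξ : Module.Dual K W),
      (∀ t ∈ T, ξ (aW t) = 0) → ∀ w ∈ Submodule.span K (aW '' T), ξ w = 0 := by
    intro T ξ hξ w hw
    have : Submodule.span K (aW '' T) ≤ LinearMap.ker ξ := Submodule.span_le.2 (by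
      rintro _ ⟨t, ht, rfl⟩
      exact hξ t ht)
    exact this hw
  refine (D.hasLinearIndexCode_iff_exists_functionals K).2
    ⟨fun t => Module.Dual.eval K W (aW t) ∘ₗ E.toLinearMap, ?_, ?_⟩
  · intro b T hb hT x hx
    have hT' := hindep' T (hindep b T hb.1 hT)
    have htop : Submodule.span K (aW '' T) = ⊤ := by
      refine Submodule.eq_top_of_finrank_eq ?_
      rw [Set.image_eq_range, finrank_span_eq_card hT', ← Nat.card_eq_fintype_card,
        Nat.card_coe_set_eq, D.ncard_eq_sum_sliceCard, Finset.sum_congr rfl fun i _ => hT i,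
        hb.sum_eq_rank, hV, rank]
    refine E.map_eq_zero_iff.1 (LinearMap.ext fun w => ?_)
    exact hspan' T (E x) hx w (htop ▸ Submodule.mem_top)
  · intro c t T hc hct hT ht x hx
    refine hspan' T (E x) hx (aW t) ?_
    have hT' := hindep' T (hindep _ T
      (hc.mem_of_le_of_ne (update_pred_lt hct).1 (update_pred_lt hct).2) hT)
    by_contra hnot
    have hins : LinearIndepOn K aW (insert t T) := (linearIndepOn_insert ht).2 ⟨hT', hnot⟩
    have hins' : LinearIndependent K fun s : ↥(insert t T) => a s :=
      hins.map' W.subtype W.ker_subtype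
    have hcard : (insert t T).ncard = ∑ i, c i := by
      rw [Set.ncard_insert_of_notMem ht (Set.toFinite _), D.ncard_eq_sum_sliceCard,
        Finset.sum_congr rfl fun i _ => hT i, sum_update_pred hct]
    have hlt := hc.rho_support_lt
    rw [← hcard, ← Nat.card_coe_set_eq, Nat.card_eq_fintype_card, ← finrank_span_eq_card hins',
      ← hV] at hlt
    refine absurd (Submodule.finrank_mono (Submodule.span_le.2 ?_)) (not_le.2 hlt)
    rintro _ ⟨⟨s, hs⟩, rfl⟩
    have hsc : c s.1 ≠ 0 := by
      rcases hs with rfl | hs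
      · exact hct
      · intro h0
        have h1 : D.sliceCard T s.1 = 0 :=
          Nat.le_zero.1 ((hT s.1).le.trans (((update_pred_lt hct).1 s.1).trans h0.le))
        rw [sliceCard, Set.ncard_eq_zero (Set.toFinite _)] at h1
        exact (h1 ▸ (show s.2 ∈ {p : Fin (D.rho {s.1}) |
          (⟨s.1, p⟩ : Σ i : Fin r, Fin (D.rho {i})) ∈ T} from hs) : s.2 ∈ (∅ : Set _))
    exact (le_iSup₂_of_le (f := fun i (_ : i ∈ {i | c i ≠ 0}) => V i) s.1 hsc le_rfl) (haV s)

theorem hasLinearIndexCode_of_representable (F : Type) [Field F] [Finite F]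
    (h : RepFnOver r D.rho F) :
    ∃ (K : Type) (_ : Field K) (_ : Fintype K),
      HasLinearIndexCode D.indexProblem K 1 (1 * D.indexCodeLen) := by
  obtain ⟨d, V, hV⟩ := h
  obtain ⟨K, _, _, _, hK⟩ := exists_finite_extension_card_gt F
    (2 ^ Fintype.card (Σ i : Fin r, Fin (D.rho {i})) + 1)
  refine ⟨K, inferInstance, Fintype.ofFinite K,
    D.hasLinearIndexCode_of_finrank_eq_rho (fun i => (V i).baseChange K) (fun X => ?_) hK⟩
  rw [← hV X, ← Submodule.finrank_baseChange_eq (K := K) (⨆ i ∈ X, V i),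
    Submodule.baseChange_biSup]

end DiscretePolymatroid

/-- **Corollary 4.** A scalar (dimension `1`) perfect linear index coding solution over
some finite field exists for the index coding problem `I^D(Z,R)` if and only if `D` is
representable over some finite field. -/
theorem scalarPerfectLinearIndexCode_iff_representable
    {r : ℕ} (hr : 0 < r) (D : DiscretePolymatroid r) :
    (∃ (F : Type) (instF : Field F) (_ : Fintype F),
        @HasLinearIndexCode _ D.indexProblem F instF 1 (1 * D.indexCodeLen)) ↔
    (∃ (F : Type) (instF : Field F) (_ : Fintype F),
        @RepFnOver r D.rho F instF) := by
  constructor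
  · rintro ⟨F, instF, hF, h⟩
    exact ⟨F, instF, hF, D.representable_of_hasLinearIndexCode F h⟩
  · rintro ⟨F, instF, hF, h⟩
    exact D.hasLinearIndexCode_of_representable F h
end

section
/- The uniform coding capacity of the following network equals 1/2: every (k,k,k;n)-FNC solution over any finite field satisfies 2k ≤ n, and over every finite field there exists a linear (1,1,1;2)-FNC solution. Vertices: 1, 2, 3, 4', 4, 5, 6, 7. Node i has an input edge generating the message x_i for i = 1, 2, 3. Edges: 1→4', 2→4', 3→4', 4'→4, 4→5, 3→6, 4→6, 2→7, 4→7. Demands: node 5 demands x_1, node 6 demands x_2, node 7 demands x_3. -/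
open scoped Classical

structure Network where
  V : Type
  E : Type
  [fintV : Fintype V]
  [fintE : Fintype E]
  hd : E → V
  tl : E → V
  acyclic : ∃ f : V → ℕ, ∀ e : E, f (hd e) < f (tl e)
  demand : V → Set E
  demand_isInput : ∀ v : V, ∀ e ∈ demand v, ∀ e' : E, tl e' ≠ hd e

namespace Network

variable (N : Network)

instance : Fintype N.V := N.fintV
instance : Fintype N.E := N.fintE

/-- An input edge: its head vertex has in-degree zero. -/
def IsInput (e : N.E) : Prop := ∀ e' : N.E, N.tl e' ≠ N.hd e

/-- The set of input edges, as a type. -/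
abbrev InputEdge : Type := {e : N.E // N.IsInput e}

/-- The space of message tuples: input edge `i` generates a row vector of length `k i`. -/
abbrev MsgSpace (F : Type) (k : N.InputEdge → ℕ) : Type :=
  ∀ i : N.InputEdge, Fin (k i) → F

/-- Incoming edges of a vertex. -/
def inSet (v : N.V) : Set N.E := {e | N.tl e = v}

/-- Outgoing intermediate edges of a vertex, together with its demands. -/
def outSet (v : N.V) : Set N.E :=
  {e | N.hd e = v ∧ ¬ N.IsInput e} ∪ N.demand v

/-- A `(k;n)`-fractional network coding solution over `F`.  The value carried by an input
edge is its message (condition (N1) is thus built in); `φ` gives the values carried by the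
intermediate edges; `decode` is condition (N2) and `localEnc` is condition (N3). -/
structure FNCSol (F : Type) [Field F] (k : N.InputEdge → ℕ) (n : ℕ) where
  φ : ∀ e : N.E, ¬ N.IsInput e → N.MsgSpace F k → (Fin n → F)
  decode : ∀ (v : N.V) (j : N.E) (hj : j ∈ N.demand v),
    ∃ χ : ((∀ i : {i : N.InputEdge // N.tl i.1 = v}, Fin (k i.1) → F) ×
           (∀ e : {e : N.E // N.tl e = v ∧ ¬ N.IsInput e}, Fin n → F)) →
          (Fin (k ⟨j, N.demand_isInput v j hj⟩) → F),
      ∀ x : N.MsgSpace F k,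
        χ (fun i => x i.1, fun e => φ e.1 e.2.2 x) = x ⟨j, N.demand_isInput v j hj⟩
  localEnc : ∀ (e : N.E) (he : ¬ N.IsInput e),
    ∃ g : ((∀ i : {i : N.InputEdge // N.tl i.1 = N.hd e}, Fin (k i.1) → F) ×
           (∀ e' : {e' : N.E // N.tl e' = N.hd e ∧ ¬ N.IsInput e'}, Fin n → F)) →
          (Fin n → F),
      ∀ x : N.MsgSpace F k, φ e he x = g (fun i => x i.1, fun e' => φ e'.1 e'.2.2 x)

/-- A solution is linear if all global encoding functions, all decoding functions and all
local encoding functions are `F`-linear. -/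
def FNCSol.IsLinear {N : Network} {F : Type} [Field F] {k : N.InputEdge → ℕ} {n : ℕ}
    (sol : N.FNCSol F k n) : Prop :=
  (∀ (e : N.E) (he : ¬ N.IsInput e), IsLinearMap F (sol.φ e he)) ∧
  (∀ (v : N.V) (j : N.E) (hj : j ∈ N.demand v),
    ∃ χ : ((∀ i : {i : N.InputEdge // N.tl i.1 = v}, Fin (k i.1) → F) ×
           (∀ e : {e : N.E // N.tl e = v ∧ ¬ N.IsInput e}, Fin n → F)) →
          (Fin (k ⟨j, N.demand_isInput v j hj⟩) → F),
      IsLinearMap F χ ∧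
      ∀ x : N.MsgSpace F k,
        χ (fun i => x i.1, fun e => sol.φ e.1 e.2.2 x) = x ⟨j, N.demand_isInput v j hj⟩) ∧
  (∀ (e : N.E) (he : ¬ N.IsInput e),
    ∃ g : ((∀ i : {i : N.InputEdge // N.tl i.1 = N.hd e}, Fin (k i.1) → F) ×
           (∀ e' : {e' : N.E // N.tl e' = N.hd e ∧ ¬ N.IsInput e'}, Fin n → F)) →
          (Fin n → F),
      IsLinearMap F g ∧
      ∀ x : N.MsgSpace F k, sol.φ e he x = g (fun i => x i.1, fun e' => sol.φ e'.1 e'.2.2 x))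

end Network

/-- The network of Fig. 8.  Vertices `0,1,2` are auxiliary sources; `3,4,5` are the nodes
`1,2,3` receiving the input edges generating `x_1,x_2,x_3`; `6,7` are `4',4`; and
`8,9,10` are the demanding nodes `5,6,7`. -/
def fncNet : Network where
  V := Fin 11
  E := Fin 12
  hd := ![0,1,2,3,4,5,6,7,5,7,4,7]
  tl := ![3,4,5,6,6,6,7,8,9,9,10,10]
  acyclic := ⟨![0,0,0,1,1,1,2,3,4,4,4], by decide⟩
  demand := fun v => {e | (v = 8 ∧ e = 0) ∨ (v = 9 ∧ e = 1) ∨ (v = 10 ∧ e = 2)}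
  demand_isInput := by
    intro v e he e'
    rcases he with ⟨_, rfl⟩|⟨_, rfl⟩|⟨_, rfl⟩ <;> (revert e'; decide)

/-- A linear map vanishing on the kernel of another one factors linearly through it. -/
theorem LinearMap.exists_comp_eq_of_ker_le_ker {F A B C : Type*} [Field F]
    [AddCommGroup A] [Module F A] [AddCommGroup B] [Module F B] [AddCommGroup C] [Module F C]
    (f : A →ₗ[F] B) (h : A →ₗ[F] C) (hfh : LinearMap.ker f ≤ LinearMap.ker h) :
    ∃ g : B →ₗ[F] C, g ∘ₗ f = h := by
  obtain ⟨g, hg⟩ := LinearMap.exists_extend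
    ((LinearMap.ker f).liftQ h hfh ∘ₗ f.quotKerEquivRange.symm.toLinearMap)
  refine ⟨g, LinearMap.ext fun x => ?_⟩
  have hx := LinearMap.congr_fun hg ⟨f x, LinearMap.mem_range_self f x⟩
  have hs : f.quotKerEquivRange.symm ⟨f x, LinearMap.mem_range_self f x⟩ =
      (LinearMap.ker f).mkQ x := f.quotKerEquivRange_symm_apply_image x _
  simpa [hs] using hx

namespace Network

variable {N : Network} {F : Type} [Field F] {k : N.InputEdge → ℕ} {n : ℕ}

namespace FNCSol

/-- The value on an edge is determined by the values entering its head. -/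
theorem φ_congr (sol : N.FNCSol F k n) {e : N.E} (he : ¬ N.IsInput e) {x y : N.MsgSpace F k}
    (hin : ∀ i : N.InputEdge, N.tl i.1 = N.hd e → x i = y i)
    (hmid : ∀ (e' : N.E) (he' : ¬ N.IsInput e'), N.tl e' = N.hd e →
      sol.φ e' he' x = sol.φ e' he' y) :
    sol.φ e he x = sol.φ e he y := by
  obtain ⟨g, hg⟩ := sol.localEnc e he
  rw [hg x, hg y]
  congr 2
  · exact funext fun i => hin i.1 i.2
  · exact funext fun e' => hmid e'.1 e'.2.2 e'.2.1

/-- A demanded message is determined by the values entering the demanding vertex. -/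
theorem msg_congr (sol : N.FNCSol F k n) {v : N.V} {j : N.E} (hj : j ∈ N.demand v)
    {x y : N.MsgSpace F k}
    (hin : ∀ i : N.InputEdge, N.tl i.1 = v → x i = y i)
    (hmid : ∀ (e' : N.E) (he' : ¬ N.IsInput e'), N.tl e' = v →
      sol.φ e' he' x = sol.φ e' he' y) :
    x ⟨j, N.demand_isInput v j hj⟩ = y ⟨j, N.demand_isInput v j hj⟩ := by
  obtain ⟨g, hg⟩ := sol.decode v j hj
  rw [← hg x, ← hg y]
  congr 2
  · exact funext fun i => hin i.1 i.2
  · exact funext fun e' => hmid e'.1 e'.2.2 e'.2.1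

end FNCSol

/-- The linear map collecting all values that enter the vertex `v`. -/
def inMap (f : N.E → N.MsgSpace F k →ₗ[F] (Fin n → F)) (v : N.V) :
    N.MsgSpace F k →ₗ[F]
      ((∀ i : {i : N.InputEdge // N.tl i.1 = v}, Fin (k i.1) → F) ×
        (∀ _ : {e : N.E // N.tl e = v ∧ ¬ N.IsInput e}, Fin n → F)) :=
  LinearMap.prod (LinearMap.pi fun i => LinearMap.proj i.1) (LinearMap.pi fun e => f e.1)

/-- Linear global encoding functions form a linear solution as soon as every value that has to
be computed vanishes whenever all the values it may depend on vanish. -/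
theorem exists_isLinear_of_ker (f : N.E → N.MsgSpace F k →ₗ[F] (Fin n → F))
    (hdec : ∀ (v : N.V) (j : N.E) (hj : j ∈ N.demand v) (x : N.MsgSpace F k),
      (∀ i : N.InputEdge, N.tl i.1 = v → x i = 0) →
      (∀ e, ¬ N.IsInput e → N.tl e = v → f e x = 0) →
      x ⟨j, N.demand_isInput v j hj⟩ = 0)
    (henc : ∀ e, ¬ N.IsInput e → ∀ x : N.MsgSpace F k,
      (∀ i : N.InputEdge, N.tl i.1 = N.hd e → x i = 0) →
      (∀ e', ¬ N.IsInput e' → N.tl e' = N.hd e → f e' x = 0) → f e x = 0) :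
    ∃ sol : N.FNCSol F k n, sol.IsLinear := by
  have hker : ∀ v x, inMap f v x = 0 → (∀ i : N.InputEdge, N.tl i.1 = v → x i = 0) ∧
      (∀ e, ¬ N.IsInput e → N.tl e = v → f e x = 0) := fun v x hx =>
    ⟨fun i hi => congr_fun (congr_arg Prod.fst hx) ⟨i, hi⟩,
      fun e he hv => congr_fun (congr_arg Prod.snd hx) ⟨e, hv, he⟩⟩
  have hD := fun v j hj => LinearMap.exists_comp_eq_of_ker_le_ker (inMap f v)
    (LinearMap.proj (⟨j, N.demand_isInput v j hj⟩ : N.InputEdge))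
    fun x hx => hdec v j hj x (hker v x hx).1 (hker v x hx).2
  have hE := fun e he => LinearMap.exists_comp_eq_of_ker_le_ker (inMap f (N.hd e)) (f e)
    fun x hx => henc e he x (hker _ x hx).1 (hker _ x hx).2
  refine ⟨⟨fun e _ => f e, fun v j hj => ?_, fun e he => ?_⟩,
    fun e _ => (f e).isLinear, fun v j hj => ?_, fun e he => ?_⟩
  · obtain ⟨g, hg⟩ := hD v j hj
    exact ⟨g, LinearMap.congr_fun hg⟩
  · obtain ⟨g, hg⟩ := hE e he
    exact ⟨g, fun x => (LinearMap.congr_fun hg x).symm⟩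
  · obtain ⟨g, hg⟩ := hD v j hj
    exact ⟨g, g.isLinear, LinearMap.congr_fun hg⟩
  · obtain ⟨g, hg⟩ := hE e he
    exact ⟨g, g.isLinear, fun x => (LinearMap.congr_fun hg x).symm⟩

end Network

namespace fncNet

theorem isInput_iff (e : Fin 12) : fncNet.IsInput e ↔ e = 0 ∨ e = 1 ∨ e = 2 := by
  change (∀ e' : Fin 12, (![3,4,5,6,6,6,7,8,9,9,10,10] : Fin 12 → Fin 11) e' ≠
    (![0,1,2,3,4,5,6,7,5,7,4,7] : Fin 12 → Fin 11) e) ↔ _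
  revert e
  decide

/-- The input edge generating the `i`-th message. -/
def input (i : Fin 3) : fncNet.InputEdge :=
  ⟨(![0, 1, 2] : Fin 3 → Fin 12) i, (isInput_iff _).2 (by revert i; decide)⟩

theorem eq_input (i : fncNet.InputEdge) : i = input 0 ∨ i = input 1 ∨ i = input 2 := by
  obtain ⟨e, he⟩ := i
  rcases (isInput_iff e).1 he with rfl | rfl | rfl
  · exact Or.inl rfl
  · exact Or.inr (Or.inl rfl)
  · exact Or.inr (Or.inr rfl)

theorem not_isInput {e : Fin 12} (he : e ≠ 0 ∧ e ≠ 1 ∧ e ≠ 2) : ¬ fncNet.IsInput e := by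
  rw [isInput_iff]
  tauto

theorem tl_input (i : Fin 3) :
    fncNet.tl (input i).1 = (![3, 4, 5] : Fin 3 → Fin 11) i := by
  revert i
  change ∀ i : Fin 3, (![3,4,5,6,6,6,7,8,9,9,10,10] : Fin 12 → Fin 11)
    ((![0, 1, 2] : Fin 3 → Fin 12) i) = (![3, 4, 5] : Fin 3 → Fin 11) i
  decide

/-- The edges entering the nodes behind the bottleneck edge `6`. -/
theorem eq_of_tl (e : Fin 12) :
    (fncNet.tl e = (5 : Fin 11) → e = 2) ∧ (fncNet.tl e = (7 : Fin 11) → e = 6) ∧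
    (fncNet.tl e = (8 : Fin 11) → e = 7) ∧ (fncNet.tl e = (9 : Fin 11) → e = 8 ∨ e = 9) := by
  revert e
  change ∀ e : Fin 12, ((![3,4,5,6,6,6,7,8,9,9,10,10] : Fin 12 → Fin 11) e = 5 → e = 2) ∧
    ((![3,4,5,6,6,6,7,8,9,9,10,10] : Fin 12 → Fin 11) e = 7 → e = 6) ∧
    ((![3,4,5,6,6,6,7,8,9,9,10,10] : Fin 12 → Fin 11) e = 8 → e = 7) ∧
    ((![3,4,5,6,6,6,7,8,9,9,10,10] : Fin 12 → Fin 11) e = 9 → e = 8 ∨ e = 9)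
  decide

theorem tl_input_lt (i : fncNet.InputEdge) :
    (show Fin 11 from fncNet.tl i.1) < 6 := by
  rcases eq_input i with rfl | rfl | rfl <;> (rw [tl_input]; decide)

variable {F : Type} [Field F] {k : fncNet.InputEdge → ℕ} {n : ℕ}

/-- For a fixed third message, the value on the bottleneck edge determines the first two. -/
theorem msg_eq_of_bottleneck_eq (sol : fncNet.FNCSol F k n) {x y : fncNet.MsgSpace F k}
    (h2 : x (input 2) = y (input 2))
    (hb : sol.φ (6 : Fin 12) (not_isInput (by decide)) x =
      sol.φ (6 : Fin 12) (not_isInput (by decide)) y) :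
    x (input 0) = y (input 0) ∧ x (input 1) = y (input 1) := by
  have hin : ∀ (v : Fin 11), 6 ≤ v → ∀ i : fncNet.InputEdge, fncNet.tl i.1 = v → x i = y i :=
    fun v hv i hi => absurd (hi ▸ tl_input_lt i) (not_lt.2 hv)
  have hmid7 : ∀ (e' : Fin 12) (he' : ¬ fncNet.IsInput e'), fncNet.tl e' = (7 : Fin 11) →
      sol.φ e' he' x = sol.φ e' he' y := by
    intro e' he' ht
    obtain rfl := (eq_of_tl e').2.1 ht
    exact hb
  constructor
  · refine sol.msg_congr (v := (8 : Fin 11)) (j := (0 : Fin 12)) (Or.inl ⟨rfl, rfl⟩)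
      (hin 8 (by decide)) fun e he ht => ?_
    obtain rfl := (eq_of_tl e).2.2.1 ht
    exact sol.φ_congr he (hin 7 (by decide)) hmid7
  · refine sol.msg_congr (v := (9 : Fin 11)) (j := (1 : Fin 12)) (Or.inr (Or.inl ⟨rfl, rfl⟩))
      (hin 9 (by decide)) fun e he ht => ?_
    rcases (eq_of_tl e).2.2.2 ht with rfl | rfl
    · refine sol.φ_congr he (fun i hi => ?_) fun e' he' ht' => ?_
      · obtain rfl : i = input 2 := Subtype.ext ((eq_of_tl i.1).1 hi)
        exact h2
      · obtain rfl := (eq_of_tl e').1 ht'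
        exact absurd ((isInput_iff 2).2 (by decide)) he'
    · exact sol.φ_congr he (hin 7 (by decide)) hmid7

theorem two_mul_le [Fintype F] {k n : ℕ} (sol : fncNet.FNCSol F (fun _ => k) n) :
    2 * k ≤ n := by
  let msg : (Fin k → F) × (Fin k → F) → fncNet.MsgSpace F (fun _ => k) := fun p i =>
    if i = input 0 then p.1 else if i = input 1 then p.2 else 0
  have h10 : input 1 ≠ input 0 := fun h => absurd (congr_arg Subtype.val h)
    (show (1 : Fin 12) ≠ 0 by decide)
  have h20 : input 2 ≠ input 0 := fun h => absurd (congr_arg Subtype.val h)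
    (show (2 : Fin 12) ≠ 0 by decide)
  have h21 : input 2 ≠ input 1 := fun h => absurd (congr_arg Subtype.val h)
    (show (2 : Fin 12) ≠ 1 by decide)
  have hinj : Function.Injective fun p =>
      sol.φ (6 : Fin 12) (not_isInput (by decide)) (msg p) := by
    intro p q hpq
    have := msg_eq_of_bottleneck_eq sol (x := msg p) (y := msg q) (by simp [msg, h20, h21]) hpq
    simpa [msg, h10, Prod.ext_iff] using this
  have hcard := Fintype.card_le_of_injective _ hinj
  simp only [Fintype.card_prod, Fintype.card_fun, Fintype.card_fin, ← pow_add] at hcard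
  have := (Nat.pow_le_pow_iff_right (Fintype.one_lt_card (α := F))).1 hcard
  omega

/-- The linear coding scheme sending `(x₁, x₂ + x₃)` over the bottleneck and forwarding single
messages on the edges leaving the sources. -/
def scheme (F : Type) [Field F] (e : Fin 12) :
    fncNet.MsgSpace F (fun _ => 1) →ₗ[F] (Fin 2 → F) :=
  let x (i : Fin 3) : fncNet.MsgSpace F (fun _ => 1) →ₗ[F] F :=
    LinearMap.proj (0 : Fin 1) ∘ₗ
      LinearMap.proj (R := F) (φ := fun _ : fncNet.InputEdge => Fin 1 → F) (input i)
  let single (i : Fin 3) := LinearMap.pi (![x i, 0] : Fin 2 → _)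
  let mixed := LinearMap.pi (![x 0, x 1 + x 2] : Fin 2 → _)
  (![0, 0, 0, single 0, single 1, single 2, mixed, mixed, single 2, mixed, single 1, mixed] :
    Fin 12 → _) e

theorem scheme_single_eq_zero_iff (x : fncNet.MsgSpace F (fun _ => 1)) :
    (scheme F 3 x = 0 ↔ x (input 0) = 0) ∧ (scheme F 4 x = 0 ↔ x (input 1) = 0) ∧
    (scheme F 5 x = 0 ↔ x (input 2) = 0) ∧ (scheme F 8 x = 0 ↔ x (input 2) = 0) ∧
    (scheme F 10 x = 0 ↔ x (input 1) = 0) := by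
  simp [scheme, funext_iff, Fin.forall_fin_two]

theorem scheme_mixed_eq_zero_iff (x : fncNet.MsgSpace F (fun _ => 1)) {e : Fin 12}
    (he : e = 6 ∨ e = 7 ∨ e = 9 ∨ e = 11) :
    scheme F e x = 0 ↔ x (input 0) = 0 ∧ x (input 1) + x (input 2) = 0 := by
  rcases he with rfl | rfl | rfl | rfl <;>
    simp [scheme, funext_iff, Fin.forall_fin_two]

theorem exists_isLinear (F : Type) [Field F] :
    ∃ sol : fncNet.FNCSol F (fun _ => 1) 2, sol.IsLinear := by
  refine Network.exists_isLinear_of_ker (scheme F) ?_ ?_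
  · rintro v j (⟨rfl, rfl⟩ | ⟨rfl, rfl⟩ | ⟨rfl, rfl⟩) x - hmid
    · have h7 := hmid (7 : Fin 12) (not_isInput (by decide)) rfl
      exact ((scheme_mixed_eq_zero_iff x (by decide)).1 h7).1
    · have h8 := (scheme_single_eq_zero_iff x).2.2.2.1.1
        (hmid (8 : Fin 12) (not_isInput (by decide)) rfl)
      have h9 := ((scheme_mixed_eq_zero_iff x (by decide)).1
        (hmid (9 : Fin 12) (not_isInput (by decide)) rfl)).2
      rwa [h8, add_zero] at h9
    · have h10 := (scheme_single_eq_zero_iff x).2.2.2.2.1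
        (hmid (10 : Fin 12) (not_isInput (by decide)) rfl)
      have h11 := ((scheme_mixed_eq_zero_iff x (by decide)).1
        (hmid (11 : Fin 12) (not_isInput (by decide)) rfl)).2
      rwa [h10, zero_add] at h11
  · intro e he x hin hmid
    have hs := scheme_single_eq_zero_iff x
    have hcases : ∀ e : Fin 12, ¬ (e = 0 ∨ e = 1 ∨ e = 2) → e = 3 ∨ e = 4 ∨ e = 5 ∨ e = 8 ∨
        e = 10 ∨ e = 6 ∨ (e = 7 ∨ e = 9 ∨ e = 11) := by decide
    rcases hcases e (mt (isInput_iff e).2 he) with rfl | rfl | rfl | rfl | rfl | rfl | h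
    · exact hs.1.2 (hin (input 0) rfl)
    · exact hs.2.1.2 (hin (input 1) rfl)
    · exact hs.2.2.1.2 (hin (input 2) rfl)
    · exact hs.2.2.2.1.2 (hin (input 2) rfl)
    · exact hs.2.2.2.2.2 (hin (input 1) rfl)
    · have h3 := hs.1.1 (hmid (3 : Fin 12) (not_isInput (by decide)) rfl)
      have h4 := hs.2.1.1 (hmid (4 : Fin 12) (not_isInput (by decide)) rfl)
      have h5 := hs.2.2.1.1 (hmid (5 : Fin 12) (not_isInput (by decide)) rfl)
      exact (scheme_mixed_eq_zero_iff x (by decide)).2 ⟨h3, by rw [h4, h5, add_zero]⟩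
    · refine (scheme_mixed_eq_zero_iff x (Or.inr h)).2
        ((scheme_mixed_eq_zero_iff x (Or.inl rfl)).1 (hmid (6 : Fin 12)
          (not_isInput (by decide)) ?_))
      rcases h with rfl | rfl | rfl <;> rfl

end fncNet

/-- **Lemma 4(3).** The uniform coding capacity of the network of Fig. 8 equals `1/2`:
every `(k,k,k;n)`-FNC solution over any finite field satisfies `k/n ≤ 1/2`, and over every
finite field there is a linear `(1,1,1;2)`-FNC solution. -/
theorem fncNet_uniform_capacity_half :
    (∀ (F : Type) [Field F] [Fintype F] (k n : ℕ),
        Nonempty (fncNet.FNCSol F (fun _ => k) n) → 2 * k ≤ n) ∧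
    (∀ (F : Type) [Field F] [Fintype F],
        ∃ sol : fncNet.FNCSol F (fun _ => 1) 2, sol.IsLinear) := by
  exact ⟨fun _ _ _ _ _ ⟨sol⟩ => fncNet.two_mul_le sol, fun F _ _ => fncNet.exists_isLinear F⟩
end
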